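/- Let n ≥ 2 be a natural number and assume v is generic. For integers 0 ≤ i < j ≤ n define a_{i,j} = [2]^{2(1+i−j)}·[2n+1−2i]·[2n−2j+2] / ([2n]·[2n+1]), where [2]^{2(1+i−j)} denotes the (possibly negative) integer power of [2]. Then: (i) a_{0,1} = 1; (ii) a_{n−2,n−1} − [5][2]²·a_{n−2,n} + ([6][5]/([3][2]))·a_{n−1,n} = 0; (iii) −[3][2]²·a_{n−2,n} + [5]·a_{n−1,n} = 0; (iv) for 0 ≤ i ≤ n−3, a_{i,i+1} − [5][2]²·a_{i,i+2} + [3][2]⁴·a_{i,i+3} + ([6][5]/([3][2]))·a_{i+1,i+2} − [5][2]²·a_{i+1,i+3} + a_{i+2,i+3} = 0; (v) for 0 ≤ i ≤ n−2, a_{i,n−1} = [4][2]·a_{i,n}; (vi) for 0 ≤ i ≤ n−3 and i+1 ≤ j ≤ n−2, a_{i,j} − [4][2]·a_{i,j+1} + [2]⁴·a_{i,j+2} = 0; (vii) for 0 ≤ i ≤ n−3 and i+3 ≤ j ≤ n, [2]⁴·a_{i,j} − [4][2]·a_{i+1,j} + a_{i+2,j} = 0; (viii) for 1 ≤ i ≤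 n−2, −[3][2]²·a_{i−1,i+1} + [2]⁴·a_{i−1,i+2} + [5]·a_{i,i+1} − [3][2]²·a_{i,i+2} = 0. -/

import Mathlib

/-- Quantum integer `[n] = (v^n - v^(-n))/(v - v⁻¹)`. -/
noncomputable def qint {K : Type*} [Field K] (v : K) (n : ℤ) : K :=
  (v ^ n - v ^ (-n)) / (v - v⁻¹)

/-- Quantum factorial `[n]! = [n]·[n-1]⋯[1]`, with `[0]! = 1`. -/
noncomputable def qfact {K : Type*} [Field K] (v : K) : ℕ → K
  | 0 => 1
  | n + 1 => qint v (n + 1) * qfact v n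

section QuantumIntegers

variable {K : Type*} [Field K] {v : K}

theorem qint_add (hv : v ≠ 0) (m k : ℤ) :
    qint v (m + k) = (v ^ m * v ^ k - (v ^ m)⁻¹ * (v ^ k)⁻¹) / (v - v⁻¹) := by
  rw [qint, zpow_neg, zpow_add₀ hv, mul_inv]

theorem qint_two (hv : v ≠ 0) (hvv : v - v⁻¹ ≠ 0) : qint v 2 = v + v⁻¹ := by
  rw [qint, div_eq_iff hvv, zpow_neg]
  norm_cast
  field_simp
  ring

theorem qint_three (hv : v ≠ 0) (hvv : v - v⁻¹ ≠ 0) :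
    qint v 3 = v ^ 2 + 1 + (v ^ 2)⁻¹ := by
  rw [qint, div_eq_iff hvv, zpow_neg]
  norm_cast
  field_simp
  ring

theorem qint_four (hv : v ≠ 0) (hvv : v - v⁻¹ ≠ 0) :
    qint v 4 = qint v 2 * (v ^ 2 + (v ^ 2)⁻¹) := by
  rw [qint_two hv hvv, qint, div_eq_iff hvv, zpow_neg]
  norm_cast
  field_simp
  ring

theorem qint_five (hv : v ≠ 0) (hvv : v - v⁻¹ ≠ 0) :
    qint v 5 = v ^ 4 + v ^ 2 + 1 + (v ^ 2)⁻¹ + (v ^ 4)⁻¹ := by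
  rw [qint, div_eq_iff hvv, zpow_neg]
  norm_cast
  field_simp
  ring

theorem qint_six (hv : v ≠ 0) (hvv : v - v⁻¹ ≠ 0) :
    qint v 6 = qint v 3 * qint v 2 * (v ^ 2 - 1 + (v ^ 2)⁻¹) := by
  rw [qint_three hv hvv, qint_two hv hvv, qint, div_eq_iff hvv, zpow_neg]
  norm_cast
  field_simp
  ring

theorem qint_add_two_add_qint_sub_two (hv : v ≠ 0) (m : ℤ) :
    qint v (m + 2) + qint v (m - 2) = (v ^ 2 + (v ^ 2)⁻¹) * qint v m := by
  have h := qint_add hv m 0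
  rw [add_zero] at h
  rw [sub_eq_add_neg, qint_add hv, qint_add hv, h]
  simp only [zpow_neg, zpow_ofNat, inv_inv]
  ring

theorem qint_quadratic_six_term (hv : v ≠ 0) (hvv : v - v⁻¹ ≠ 0) (m : ℤ) :
    qint v (m + 1) * qint v m - qint v 5 * (qint v (m + 1) * qint v (m - 2))
      + qint v 3 * (qint v (m + 1) * qint v (m - 4))
      + qint v 5 * (v ^ 2 - 1 + (v ^ 2)⁻¹) * (qint v (m - 1) * qint v (m - 2))
      - qint v 5 * (qint v (m - 1) * qint v (m - 4))
      + qint v (m - 3) * qint v (m - 4) = 0 := by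
  have hx : v ^ m ≠ 0 := zpow_ne_zero m hv
  have h := qint_add hv m 0
  rw [add_zero] at h
  simp only [sub_eq_add_neg m, qint_add hv m, h, qint_three hv hvv, qint_five hv hvv]
  simp only [zpow_neg, zpow_ofNat, inv_inv]
  generalize v ^ m = x at hx
  generalize (v - v⁻¹) = e at hvv
  field_simp
  ring

theorem qint_quadratic_four_term (hv : v ≠ 0) (hvv : v - v⁻¹ ≠ 0) (m : ℤ) :
    -qint v 3 * (qint v (m + 1) * qint v (m - 2)) + qint v (m + 1) * qint v (m - 4)
      + qint v 5 * (qint v (m - 1) * qint v (m - 2))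
      - qint v 3 * (qint v (m - 1) * qint v (m - 4)) = 0 := by
  have hx : v ^ m ≠ 0 := zpow_ne_zero m hv
  simp only [sub_eq_add_neg m, qint_add hv m, qint_three hv hvv, qint_five hv hvv]
  simp only [zpow_neg, zpow_ofNat, inv_inv]
  generalize v ^ m = x at hx
  generalize (v - v⁻¹) = e at hvv
  field_simp
  ring

end QuantumIntegers

theorem stmt11 {K : Type*} [Field K] (v : K) (hv : v ≠ 0) (hvv : v - v⁻¹ ≠ 0)
    (hgen : ∀ m : ℤ, 1 ≤ m → qint v m ≠ 0)
    (n : ℕ) (hn : 2 ≤ n)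
    (A : ℕ → ℕ → K)
    (hA : ∀ i j : ℕ, i < j → j ≤ n →
      A i j = qint v 2 ^ (2 * (1 + (i : ℤ) - j)) *
        (qint v (2 * n + 1 - 2 * i : ℤ) * qint v (2 * n - 2 * j + 2 : ℤ)) /
        (qint v (2 * n : ℤ) * qint v (2 * n + 1 : ℤ))) :
    A 0 1 = 1 ∧
    (A (n - 2) (n - 1) - qint v 5 * qint v 2 ^ 2 * A (n - 2) n
        + (qint v 6 * qint v 5 / (qint v 3 * qint v 2)) * A (n - 1) n = 0) ∧
    (-(qint v 3 * qint v 2 ^ 2) * A (n - 2) n + qint v 5 * A (n - 1) n = 0) ∧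
    (∀ i : ℕ, i + 3 ≤ n →
      A i (i + 1) - qint v 5 * qint v 2 ^ 2 * A i (i + 2)
        + qint v 3 * qint v 2 ^ 4 * A i (i + 3)
        + (qint v 6 * qint v 5 / (qint v 3 * qint v 2)) * A (i + 1) (i + 2)
        - qint v 5 * qint v 2 ^ 2 * A (i + 1) (i + 3)
        + A (i + 2) (i + 3) = 0) ∧
    (∀ i : ℕ, i + 2 ≤ n → A i (n - 1) = qint v 4 * qint v 2 * A i n) ∧
    (∀ i j : ℕ, i + 3 ≤ n → i + 1 ≤ j → j + 2 ≤ n →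
      A i j - qint v 4 * qint v 2 * A i (j + 1)
        + qint v 2 ^ 4 * A i (j + 2) = 0) ∧
    (∀ i j : ℕ, i + 3 ≤ n → i + 3 ≤ j → j ≤ n →
      qint v 2 ^ 4 * A i j - qint v 4 * qint v 2 * A (i + 1) j
        + A (i + 2) j = 0) ∧
    (∀ i : ℕ, 1 ≤ i → i + 2 ≤ n →
      -(qint v 3 * qint v 2 ^ 2) * A (i - 1) (i + 1)
        + qint v 2 ^ 4 * A (i - 1) (i + 2)
        + qint v 5 * A i (i + 1)
        - qint v 3 * qint v 2 ^ 2 * A i (i + 2) = 0) := by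
  have h2 : qint v 2 ≠ 0 := hgen 2 (by norm_num)
  have h3 : qint v 3 ≠ 0 := hgen 3 (by norm_num)
  have hD : qint v (2 * n : ℤ) * qint v (2 * n + 1 : ℤ) ≠ 0 :=
    mul_ne_zero (hgen _ (by omega)) (hgen _ (by omega))
  have h65 : qint v 6 * qint v 5 / (qint v 3 * qint v 2)
      = qint v 5 * (v ^ 2 - 1 + (v ^ 2)⁻¹) := by
    rw [qint_six hv hvv]
    field_simp
  have h4 := qint_four hv hvv
  set D := qint v (2 * n : ℤ) * qint v (2 * n + 1 : ℤ) with hDdef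
  have hB : ∀ i j k : ℕ, ∀ m p q : ℤ, j = i + k + 1 → j ≤ n → m = 2 * ((n : ℤ) - i) →
      p = m + 1 → q = m - 2 * k →
      (qint v 2 ^ 2) ^ k * A i j = qint v p * qint v q / D := by
    rintro i j k m p q rfl hj rfl rfl rfl
    rw [hA i _ (by omega) hj, ← pow_mul, ← zpow_natCast, mul_div_assoc, ← mul_assoc,
      ← zpow_add₀ h2]
    push_cast
    rw [show (2 * (k : ℤ) + 2 * (1 + (i : ℤ) - (i + k + 1))) = 0 by ring, zpow_zero, one_mul]
    rw [show 2 * (n : ℤ) + 1 - 2 * i = 2 * ((n : ℤ) - i) + 1 by ring,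
      show 2 * (n : ℤ) - 2 * (i + k + 1) + 2 = 2 * ((n : ℤ) - i) - 2 * k by ring]
  refine ⟨?_, ?_, ?_, ?_, ?_, ?_, ?_, ?_⟩
  · have h := hB 0 1 0 (2 * n) (2 * n + 1) (2 * n) rfl (by omega) (by simp) rfl (by simp)
    rw [pow_zero, one_mul, mul_comm (qint v _), ← hDdef, div_self hD] at h
    exact h
  · have e1 := hB (n - 2) (n - 1) 0 4 5 4 (by omega) (by omega) (by omega) rfl rfl
    have e2 := hB (n - 2) n 1 4 5 2 (by omega) le_rfl (by omega) rfl rfl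
    have e3 := hB (n - 1) n 0 2 3 2 (by omega) le_rfl (by omega) rfl rfl
    have h6 : qint v 5 * (v ^ 2 - 1 + (v ^ 2)⁻¹) * (qint v 3 * qint v 2)
        = qint v 6 * qint v 5 := by
      rw [← h65]
      field_simp
    have h46 : qint v 6 + qint v 4 = qint v 5 * qint v 2 := by
      rw [h4, qint_six hv hvv, qint_five hv hvv, qint_three hv hvv, qint_two hv hvv]
      field_simp
      ring
    rw [h65]
    linear_combination e1 - qint v 5 * e2 + qint v 5 * (v ^ 2 - 1 + (v ^ 2)⁻¹) * e3
      + h6 / D + qint v 5 / D * h46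
  · have e2 := hB (n - 2) n 1 4 5 2 (by omega) le_rfl (by omega) rfl rfl
    have e3 := hB (n - 1) n 0 2 3 2 (by omega) le_rfl (by omega) rfl rfl
    linear_combination -qint v 3 * e2 + qint v 5 * e3
  · intro i hi
    obtain ⟨m, hm⟩ : ∃ m : ℤ, m = 2 * ((n : ℤ) - i) := ⟨_, rfl⟩
    have e1 := hB i (i + 1) 0 m (m + 1) m (by omega) (by omega) (by omega) rfl (by omega)
    have e2 := hB i (i + 2) 1 m (m + 1) (m - 2) (by omega) (by omega) (by omega) rfl (by omega)
    have e3 := hB i (i + 3) 2 m (m + 1) (m - 4) (by omega) (by omega) (by omega) rfl (by omega)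
    have e4 := hB (i + 1) (i + 2) 0 (m - 2) (m - 1) (m - 2)
      (by omega) (by omega) (by omega) (by omega) (by omega)
    have e5 := hB (i + 1) (i + 3) 1 (m - 2) (m - 1) (m - 4)
      (by omega) (by omega) (by omega) (by omega) (by omega)
    have e6 := hB (i + 2) (i + 3) 0 (m - 4) (m - 3) (m - 4)
      (by omega) (by omega) (by omega) (by omega) (by omega)
    rw [h65]
    linear_combination e1 - qint v 5 * e2 + qint v 3 * e3
      + qint v 5 * (v ^ 2 - 1 + (v ^ 2)⁻¹) * e4 - qint v 5 * e5 + e6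
      + qint_quadratic_six_term hv hvv m / D
  · intro i hi
    obtain ⟨k, rfl⟩ : ∃ k, n = i + 2 + k := ⟨n - (i + 2), by omega⟩
    have e1 := hB i (i + 2 + k - 1) k (2 * k + 4) (2 * k + 5) 4
      (by omega) (by omega) (by omega) (by omega) (by omega)
    have e2 := hB i (i + 2 + k) (k + 1) (2 * k + 4) (2 * k + 5) 2
      (by omega) (by omega) (by omega) (by omega) (by omega)
    apply mul_left_cancel₀ (pow_ne_zero k (pow_ne_zero 2 h2))
    rw [pow_succ] at e2
    rw [h4] at e1 ⊢
    linear_combination e1 - (v ^ 2 + (v ^ 2)⁻¹) * e2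
  · intro i j hi hij hj
    obtain ⟨k, rfl⟩ : ∃ k, j = i + k + 1 := ⟨j - (i + 1), by omega⟩
    obtain ⟨m, hm⟩ : ∃ m : ℤ, m = 2 * ((n : ℤ) - i) := ⟨_, rfl⟩
    obtain ⟨q, hq⟩ : ∃ q : ℤ, q = m - 2 * k - 2 := ⟨_, rfl⟩
    have e1 := hB i (i + k + 1) k m (m + 1) (q + 2)
      (by omega) (by omega) (by omega) (by omega) (by omega)
    have e2 := hB i (i + k + 1 + 1) (k + 1) m (m + 1) q
      (by omega) (by omega) (by omega) (by omega) (by omega)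
    have e3 := hB i (i + k + 1 + 2) (k + 2) m (m + 1) (q - 2)
      (by omega) (by omega) (by omega) (by omega) (by omega)
    apply mul_left_cancel₀ (pow_ne_zero k (pow_ne_zero 2 h2))
    rw [pow_add] at e2 e3
    rw [h4]
    linear_combination e1 - (v ^ 2 + (v ^ 2)⁻¹) * e2 + e3
      + qint v (m + 1) / D * qint_add_two_add_qint_sub_two hv q
  · intro i j hi hij hj
    obtain ⟨k, rfl⟩ : ∃ k, j = i + 3 + k := ⟨j - (i + 3), by omega⟩
    obtain ⟨p, hp⟩ : ∃ p : ℤ, p = 2 * ((n : ℤ) - i) - 1 := ⟨_, rfl⟩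
    obtain ⟨q, hq⟩ : ∃ q : ℤ, q = 2 * ((n : ℤ) - i) - 2 * k - 4 := ⟨_, rfl⟩
    have e1 := hB i (i + 3 + k) (k + 2) (p + 1) (p + 2) q
      (by omega) (by omega) (by omega) (by omega) (by omega)
    have e2 := hB (i + 1) (i + 3 + k) (k + 1) (p - 1) p q
      (by omega) (by omega) (by omega) (by omega) (by omega)
    have e3 := hB (i + 2) (i + 3 + k) k (p - 3) (p - 2) q
      (by omega) (by omega) (by omega) (by omega) (by omega)
    apply mul_left_cancel₀ (pow_ne_zero k (pow_ne_zero 2 h2))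
    rw [pow_add] at e1 e2
    rw [h4]
    linear_combination e1 - (v ^ 2 + (v ^ 2)⁻¹) * e2 + e3
      + qint v q / D * qint_add_two_add_qint_sub_two hv p
  · intro i hi hin
    obtain ⟨m, hm⟩ : ∃ m : ℤ, m = 2 * ((n : ℤ) - i) + 2 := ⟨_, rfl⟩
    have e1 := hB (i - 1) (i + 1) 1 m (m + 1) (m - 2)
      (by omega) (by omega) (by omega) rfl (by omega)
    have e2 := hB (i - 1) (i + 2) 2 m (m + 1) (m - 4)
      (by omega) (by omega) (by omega) rfl (by omega)
    have e3 := hB i (i + 1) 0 (m - 2) (m - 1) (m - 2)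
      (by omega) (by omega) (by omega) (by omega) (by omega)
    have e4 := hB i (i + 2) 1 (m - 2) (m - 1) (m - 4)
      (by omega) (by omega) (by omega) (by omega) (by omega)
    linear_combination -qint v 3 * e1 + e2 + qint v 5 * e3 - qint v 3 * e4
      + qint_quadratic_four_term hv hvv m / D
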